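/- Let Ω ⊂ ℝⁿ be a smooth bounded domain with n ≥ 2, let g be a C^∞ function, and let u, smooth on the closure of Ω, be a semi-stable classical solution of −Δu = g(u) in Ω with u = 0 on ∂Ω. Then for every s > 0 one has (n−1) s² ∫_{{|u|>s} ∩ {|∇u|>0}} H_u² |∇u|² dx ≤ ∫_{{|u| ≤ s}} |∇u|⁴ dx. -/

import Mathlib

open MeasureTheory Filter Bornology
open scoped ENNReal Topology

/-- Divergence of a vector field on `ℝⁿ = EuclideanSpace ℝ (Fin n)`. -/
noncomputable def divg {n : ℕ} (V : EuclideanSpace ℝ (Fin n) → EuclideanSpace ℝ (Fin n))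
    (x : EuclideanSpace ℝ (Fin n)) : ℝ :=
  ∑ i, fderiv ℝ V x (EuclideanSpace.single i 1) i

/-- `H_u(x) = -(1/(n-1)) div(∇u/|∇u|)(x)`, the mean curvature of the level set of `|u|`
through `x` (at points where `∇u(x) ≠ 0`). -/
noncomputable def meanCurv {n : ℕ} (u : EuclideanSpace ℝ (Fin n) → ℝ)
    (x : EuclideanSpace ℝ (Fin n)) : ℝ :=
  -(1 / ((n : ℝ) - 1)) * divg (fun y => ‖gradient u y‖⁻¹ • gradient u y) x

/-- The Laplacian `Δu = div ∇u` on `ℝⁿ`. -/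
noncomputable def lap {n : ℕ} (u : EuclideanSpace ℝ (Fin n) → ℝ)
    (x : EuclideanSpace ℝ (Fin n)) : ℝ :=
  divg (gradient u) x

/-- Semi-stability of a solution `u` of `-Δu = g(u)` in `Ω`, `u = 0` on `∂Ω`:
`∫_Ω (|∇ξ|² - g'(u) ξ²) dx ≥ 0` for every `C¹` function `ξ` vanishing on `∂Ω`. -/
def SemiStable {n : ℕ} (Ω : Set (EuclideanSpace ℝ (Fin n))) (g : ℝ → ℝ)
    (u : EuclideanSpace ℝ (Fin n) → ℝ) : Prop :=
  ∀ ξ : EuclideanSpace ℝ (Fin n) → ℝ, ContDiff ℝ 1 ξ → (∀ x ∈ frontier Ω, ξ x = 0) →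
    0 ≤ ∫ x in Ω, (‖gradient ξ x‖ ^ 2 - deriv g (u x) * ξ x ^ 2)

/-- The `i`-th partial derivative of a function on `ℝⁿ`. -/
noncomputable def partialDeriv {n : ℕ} (i : Fin n) (f : EuclideanSpace ℝ (Fin n) → ℝ)
    (x : EuclideanSpace ℝ (Fin n)) : ℝ :=
  fderiv ℝ f x (EuclideanSpace.single i 1)

section PartialDeriv

variable {n : ℕ} {f h : EuclideanSpace ℝ (Fin n) → ℝ} {x : EuclideanSpace ℝ (Fin n)}

theorem gradient_apply (f : EuclideanSpace ℝ (Fin n) → ℝ) (x : EuclideanSpace ℝ (Fin n))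
    (i : Fin n) : gradient f x i = partialDeriv i f x := by
  rw [partialDeriv, ← inner_gradient_left, EuclideanSpace.inner_single_right]
  simp

theorem norm_gradient_sq (f : EuclideanSpace ℝ (Fin n) → ℝ) (x : EuclideanSpace ℝ (Fin n)) :
    ‖gradient f x‖ ^ 2 = ∑ i, partialDeriv i f x ^ 2 := by
  simp_rw [EuclideanSpace.real_norm_sq_eq, gradient_apply]

theorem contDiff_partialDeriv (i : Fin n) (hf : ContDiff ℝ (⊤ : ℕ∞) f) :
    ContDiff ℝ (⊤ : ℕ∞) (partialDeriv i f) :=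
  (hf.fderiv_right (m := (⊤ : ℕ∞)) (by simp)).clm_apply contDiff_const

theorem continuous_partialDeriv (i : Fin n) (hf : ContDiff ℝ 1 f) :
    Continuous (partialDeriv i f) :=
  (hf.continuous_fderiv (by simp)).clm_apply continuous_const

theorem partialDeriv_comm (hf : ContDiff ℝ (⊤ : ℕ∞) f) (i j : Fin n) :
    partialDeriv i (partialDeriv j f) = partialDeriv j (partialDeriv i f) := by
  have hd : Differentiable ℝ (fderiv ℝ f) :=
    (hf.fderiv_right (m := (⊤ : ℕ∞)) (by simp)).differentiable (by simp)
  have key (k l : Fin n) (y : EuclideanSpace ℝ (Fin n)) : partialDeriv k (partialDeriv l f) y =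
      fderiv ℝ (fderiv ℝ f) y (EuclideanSpace.single k 1) (EuclideanSpace.single l 1) := by
    unfold partialDeriv
    rw [fderiv_clm_apply (hd y) (by fun_prop)]
    simp
  ext y
  rw [key, key]
  exact hf.contDiffAt.isSymmSndFDerivAt
    (by rw [minSmoothness_of_isRCLikeNormedField]; exact WithTop.coe_le_coe.2 le_top) _ _

theorem partialDeriv_mul (i : Fin n) (hf : DifferentiableAt ℝ f x) (hh : DifferentiableAt ℝ h x) :
    partialDeriv i (fun y => f y * h y) x =
      f x * partialDeriv i h x + h x * partialDeriv i f x := by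
  unfold partialDeriv
  rw [fderiv_fun_mul hf hh]
  simp

theorem partialDeriv_sum {ι : Type*} (s : Finset ι) {F : ι → EuclideanSpace ℝ (Fin n) → ℝ}
    (i : Fin n) (hF : ∀ k ∈ s, DifferentiableAt ℝ (F k) x) :
    partialDeriv i (fun y => ∑ k ∈ s, F k y) x = ∑ k ∈ s, partialDeriv i (F k) x := by
  unfold partialDeriv
  rw [fderiv_fun_sum hF]
  simp

theorem partialDeriv_comp {φ : ℝ → ℝ} (i : Fin n) (hφ : DifferentiableAt ℝ φ (f x))
    (hf : DifferentiableAt ℝ f x) :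
    partialDeriv i (fun y => φ (f y)) x = deriv φ (f x) * partialDeriv i f x := by
  have := (hφ.hasDerivAt.comp_hasFDerivAt x hf.hasFDerivAt).fderiv
  unfold partialDeriv
  rw [show (fun y => φ (f y)) = φ ∘ f from rfl, this]
  simp

theorem partialDeriv_congr (i : Fin n) (hfh : f =ᶠ[𝓝 x] h) :
    partialDeriv i f x = partialDeriv i h x := by
  unfold partialDeriv
  rw [hfh.fderiv_eq]

theorem partialDeriv_sqrt (i : Fin n) (hf : DifferentiableAt ℝ f x) (h0 : f x ≠ 0) :
    partialDeriv i (fun y => √(f y)) x = partialDeriv i f x / (2 * √(f x)) := by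
  rw [partialDeriv_comp i (Real.hasDerivAt_sqrt h0).differentiableAt hf,
    (Real.hasDerivAt_sqrt h0).deriv]
  ring

theorem divg_eq_sum {V : EuclideanSpace ℝ (Fin n) → EuclideanSpace ℝ (Fin n)}
    (hV : ∀ i, DifferentiableAt ℝ (fun y => V y i) x) :
    divg V x = ∑ i, partialDeriv i (fun y => V y i) x := by
  have hd : DifferentiableAt ℝ V x := differentiableAt_euclidean.2 hV
  refine Finset.sum_congr rfl fun i _ => ?_
  have := ((EuclideanSpace.proj i : EuclideanSpace ℝ (Fin n) →L[ℝ] ℝ).hasFDerivAt.comp x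
    hd.hasFDerivAt).fderiv
  unfold partialDeriv
  rw [show (fun y => V y i) = (EuclideanSpace.proj i : EuclideanSpace ℝ (Fin n) →L[ℝ] ℝ) ∘ V
    from rfl, this]
  simp

theorem lap_eq_sum (hf : ContDiff ℝ (⊤ : ℕ∞) f) (x : EuclideanSpace ℝ (Fin n)) :
    lap f x = ∑ i, partialDeriv i (partialDeriv i f) x := by
  unfold lap
  have h (i : Fin n) : (fun y => gradient f y i) = partialDeriv i f :=
    funext fun y => gradient_apply f y i
  rw [divg_eq_sum fun i => by
    rw [h]; exact (contDiff_partialDeriv i hf).differentiable (by simp) x]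
  simp_rw [h]

/-- `∂ᵢ|∇f|² = 2 (D²f ∇f)ᵢ`. -/
theorem partialDeriv_sum_sq (hf : ContDiff ℝ (⊤ : ℕ∞) f) (i : Fin n)
    (x : EuclideanSpace ℝ (Fin n)) :
    partialDeriv i (fun y => ∑ j, partialDeriv j f y ^ 2) x =
      2 * ∑ j, partialDeriv i (partialDeriv j f) x * partialDeriv j f x := by
  have hd (j : Fin n) : DifferentiableAt ℝ (partialDeriv j f) x :=
    (contDiff_partialDeriv j hf).differentiable (by simp) x
  rw [partialDeriv_sum (F := fun j y => partialDeriv j f y ^ 2) _ _ fun j _ => (hd j).pow 2,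
    Finset.mul_sum]
  refine Finset.sum_congr rfl fun j _ => ?_
  simp_rw [pow_two]
  rw [partialDeriv_mul i (hd j) (hd j)]
  ring

theorem divg_normalized_gradient (hf : ContDiff ℝ (⊤ : ℕ∞) f)
    (hx : gradient f x ≠ 0) :
    divg (fun y => ‖gradient f y‖⁻¹ • gradient f y) x * ‖gradient f x‖ =
      ∑ i, partialDeriv i (partialDeriv i f) x -
        (∑ i, (∑ j, partialDeriv i (partialDeriv j f) x * partialDeriv j f x) *
          partialDeriv i f x) / ∑ i, partialDeriv i f x ^ 2 := by
  set w : EuclideanSpace ℝ (Fin n) → ℝ := fun y => ∑ j, partialDeriv j f y ^ 2 with hw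
  have hnorm (y : EuclideanSpace ℝ (Fin n)) : ‖gradient f y‖ = √(w y) := by
    change _ = √(∑ j, partialDeriv j f y ^ 2)
    rw [← norm_gradient_sq, Real.sqrt_sq (norm_nonneg _)]
  have hd (j : Fin n) : DifferentiableAt ℝ (partialDeriv j f) x :=
    (contDiff_partialDeriv j hf).differentiable (by simp) x
  have hwd : DifferentiableAt ℝ w x := by
    simp only [hw]
    fun_prop
  have hwx : 0 < √(w x) := by rw [← hnorm]; exact norm_pos_iff.2 hx
  have hw0 : w x ≠ 0 := fun h => by simp [h] at hwx
  have hsd : DifferentiableAt ℝ (fun y => √(w y)) x := hwd.sqrt hw0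
  have hcoord (i : Fin n) : (fun y => (‖gradient f y‖⁻¹ • gradient f y) i) =
      fun y => (√(w y))⁻¹ * partialDeriv i f y := by
    ext y
    simp [hnorm, gradient_apply]
  have hid : DifferentiableAt ℝ (fun y => (√(w y))⁻¹) x := hsd.inv hwx.ne'
  have hinv (i : Fin n) : partialDeriv i (fun y => (√(w y))⁻¹) x =
      -(∑ j, partialDeriv i (partialDeriv j f) x * partialDeriv j f x) / (w x * √(w x)) := by
    rw [partialDeriv_comp (φ := fun t => t⁻¹) i (differentiableAt_inv hwx.ne') hsd,
      partialDeriv_sqrt i hwd hw0, partialDeriv_sum_sq hf, deriv_inv,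
      Real.sq_sqrt (Finset.sum_nonneg fun _ _ => sq_nonneg _)]
    change -(w x)⁻¹ * _ = _
    field_simp
  rw [divg_eq_sum fun i => by rw [hcoord]; exact hid.mul (hd i), hnorm, Finset.sum_mul]
  simp_rw [hcoord]
  rw [Finset.sum_div, ← Finset.sum_sub_distrib]
  refine Finset.sum_congr rfl fun i _ => ?_
  rw [partialDeriv_mul i hid (hd i), hinv]
  change _ = _ - _ / w x
  field_simp
  ring

end PartialDeriv

/-- If `v ≠ 0` and `P` is the orthogonal projection onto `v^⊥`, then
`(tr (a P))² ≤ (n - 1) |a P|²`. -/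
theorem sq_trace_sub_le {n : ℕ} (a : Fin n → Fin n → ℝ) (v : Fin n → ℝ)
    (hv : ∑ i, v i ^ 2 ≠ 0) :
    (∑ i, a i i - (∑ i, (∑ j, a i j * v j) * v i) / ∑ i, v i ^ 2) ^ 2 ≤
      ((n : ℝ) - 1) *
        (∑ i, ∑ j, a i j ^ 2 - (∑ i, (∑ j, a i j * v j) ^ 2) / ∑ i, v i ^ 2) := by
  set b : Fin n → ℝ := fun i => ∑ j, a i j * v j with hb
  obtain ⟨S, hS⟩ : ∃ S, S = ∑ i, v i ^ 2 := ⟨_, rfl⟩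
  have hS0 : S ≠ 0 := hS ▸ hv
  rw [← hS]
  have hbi (i : Fin n) : ∑ j, a i j * v j = b i := rfl
  set δ : Fin n → Fin n → ℝ := fun i j => if i = j then 1 else 0 with hδ
  have h1 : ∑ p : Fin n × Fin n, (a p.1 p.2 - b p.1 * v p.2 / S) *
      (δ p.1 p.2 - v p.1 * v p.2 / S) = ∑ i, a i i - (∑ i, b i * v i) / S := by
    rw [Fintype.sum_prod_type]
    rw [Finset.sum_div, ← Finset.sum_sub_distrib]
    refine Finset.sum_congr rfl fun i _ => ?_
    have e (j : Fin n) : (a i j - b i * v j / S) * (δ i j - v i * v j / S) =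
        (a i j * δ i j - b i / S * (v j * δ i j)) - (v i / S * (a i j * v j) -
          b i * v i / S ^ 2 * v j ^ 2) := by
      field_simp
    simp_rw [e, Finset.sum_sub_distrib, ← Finset.mul_sum, ← hS, hbi]
    simp only [hδ, mul_ite, mul_one, mul_zero, Finset.sum_ite_eq, Finset.mem_univ, if_true]
    field_simp
    ring
  have h2 : ∑ p : Fin n × Fin n, (a p.1 p.2 - b p.1 * v p.2 / S) ^ 2 =
      ∑ i, ∑ j, a i j ^ 2 - (∑ i, b i ^ 2) / S := by
    rw [Fintype.sum_prod_type, Finset.sum_div, ← Finset.sum_sub_distrib]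
    refine Finset.sum_congr rfl fun i _ => ?_
    have e (j : Fin n) : (a i j - b i * v j / S) ^ 2 =
        a i j ^ 2 - 2 * b i / S * (a i j * v j) + b i ^ 2 / S ^ 2 * v j ^ 2 := by
      field_simp
      ring
    simp_rw [e, Finset.sum_add_distrib, Finset.sum_sub_distrib, ← Finset.mul_sum, ← hS, hbi]
    field_simp
    ring
  have h3 : ∑ p : Fin n × Fin n, (δ p.1 p.2 - v p.1 * v p.2 / S) ^ 2 = (n : ℝ) - 1 := by
    have e (i j : Fin n) : (δ i j - v i * v j / S) ^ 2 =
        δ i j - 2 * v i / S * (v j * δ i j) + v i ^ 2 / S ^ 2 * v j ^ 2 := by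
      simp only [hδ]
      split_ifs <;> field_simp <;> ring
    simp_rw [Fintype.sum_prod_type, e, Finset.sum_add_distrib, Finset.sum_sub_distrib,
      ← Finset.mul_sum, ← hS]
    simp only [hδ, mul_ite, mul_one, mul_zero, Finset.sum_ite_eq, Finset.mem_univ, if_true]
    have e2 (i : Fin n) : 2 * v i / S * v i = 2 / S * v i ^ 2 := by ring
    simp_rw [e2, ← Finset.sum_mul, ← Finset.mul_sum, ← Finset.sum_div, ← hS]
    simp
    field_simp
    ring
  have := Finset.sum_mul_sq_le_sq_mul_sq (Finset.univ : Finset (Fin n × Fin n))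
    (fun p => a p.1 p.2 - b p.1 * v p.2 / S) (fun p => δ p.1 p.2 - v p.1 * v p.2 / S)
  rw [h1, h2, h3] at this
  linarith

/-- A `C¹` approximation of the truncation `t ↦ max (-s) (min t s)` vanishing near `0`. -/
theorem exists_truncation {s δ : ℝ} (hδ : 0 < δ) (hs : 3 * δ < s) :
    ∃ φ : ℝ → ℝ, ContDiff ℝ 1 φ ∧ (∀ t, |t| ≤ δ → φ t = 0) ∧ (∀ t, deriv φ t ^ 2 ≤ 1) ∧
      (∀ t, s ≤ |t| → deriv φ t = 0) ∧ ∀ t, s ≤ |t| → (s - 3 * δ) ^ 2 ≤ φ t ^ 2 := by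
  set ψ : ℝ → ℝ := fun t => max 0 (min 1 (min ((|t| - δ) / δ) ((s - |t|) / δ))) with hψ
  have hc : Continuous ψ := by fun_prop
  have hψ0 (t : ℝ) : 0 ≤ ψ t := le_max_left _ _
  have hψ1 (t : ℝ) : ψ t ≤ 1 := max_le zero_le_one (min_le_left _ _)
  have hneg (t : ℝ) : ψ (-t) = ψ t := by simp only [hψ, abs_neg]
  have hsmall (t : ℝ) (ht : |t| ≤ δ) : ψ t = 0 := by
    refine max_eq_left ((min_le_right _ _).trans ((min_le_left _ _).trans ?_))
    exact div_nonpos_of_nonpos_of_nonneg (by linarith) hδ.le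
  have hlarge (t : ℝ) (ht : s ≤ |t|) : ψ t = 0 := by
    refine max_eq_left ((min_le_right _ _).trans ((min_le_right _ _).trans ?_))
    exact div_nonpos_of_nonpos_of_nonneg (by linarith) hδ.le
  have hone (t : ℝ) (h1 : 2 * δ ≤ t) (h2 : t ≤ s - δ) : ψ t = 1 := by
    have e1 : 1 ≤ (|t| - δ) / δ := by
      rw [abs_of_nonneg (by linarith), le_div_iff₀ hδ]; linarith
    have e2 : 1 ≤ (s - |t|) / δ := by
      rw [abs_of_nonneg (by linarith), le_div_iff₀ hδ]; linarith
    simp only [hψ]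
    rw [min_eq_left (le_min e1 e2), max_eq_right zero_le_one]
  have hii (a b : ℝ) : IntervalIntegrable ψ volume a b := hc.intervalIntegrable a b
  have hderiv (t : ℝ) : HasDerivAt (fun t => ∫ τ in (0 : ℝ)..t, ψ τ) (ψ t) t :=
    intervalIntegral.integral_hasDerivAt_right (hii 0 t)
      hc.stronglyMeasurable.stronglyMeasurableAtFilter hc.continuousAt
  have hd : deriv (fun t => ∫ τ in (0 : ℝ)..t, ψ τ) = ψ := funext fun t => (hderiv t).deriv
  have hodd (t : ℝ) : ∫ τ in (0 : ℝ)..(-t), ψ τ = -∫ τ in (0 : ℝ)..t, ψ τ := by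
    have := intervalIntegral.integral_comp_neg (a := 0) (b := t) ψ
    simp only [hneg, neg_zero] at this
    rw [this, intervalIntegral.integral_symm]
  have hpos (t : ℝ) (ht : s ≤ t) : s - 3 * δ ≤ ∫ τ in (0 : ℝ)..t, ψ τ := by
    calc s - 3 * δ = ∫ τ in (2 * δ)..(s - δ), ψ τ := by
          rw [intervalIntegral.integral_congr (g := fun _ => (1 : ℝ))]
          · simp; ring
          · intro τ hτ
            rw [Set.uIcc_of_le (by linarith)] at hτ
            exact hone τ hτ.1 hτ.2
      _ ≤ ∫ τ in (0 : ℝ)..t, ψ τ :=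
          intervalIntegral.integral_mono_interval (by linarith) (by linarith) (by linarith)
            (Eventually.of_forall hψ0) (hii _ _)
  refine ⟨fun t => ∫ τ in (0 : ℝ)..t, ψ τ, ?_, ?_, ?_, ?_, ?_⟩
  · rw [contDiff_one_iff_deriv, hd]
    exact ⟨fun t => (hderiv t).differentiableAt, hc⟩
  · intro t ht
    refine intervalIntegral.integral_zero_ae (Eventually.of_forall fun τ hτ => hsmall τ ?_)
    refine le_trans ?_ ht
    have := Set.abs_sub_left_of_mem_uIcc (Set.uIoc_subset_uIcc hτ)
    simpa using this
  · intro t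
    rw [hd]
    exact pow_le_one₀ (hψ0 t) (hψ1 t)
  · intro t ht
    rw [hd]
    exact hlarge t ht
  · intro t ht
    rw [sq_le_sq, abs_of_pos (by linarith)]
    rcases le_total 0 t with h0 | h0
    · rw [abs_of_nonneg h0] at ht
      exact (hpos t ht).trans (le_abs_self _)
    · rw [abs_of_nonpos h0] at ht
      refine (hpos (-t) ht).trans ?_
      rw [hodd]
      exact neg_le_abs _

section Cutoff

variable {n : ℕ} {Ω : Set (EuclideanSpace ℝ (Fin n))} {u : EuclideanSpace ℝ (Fin n) → ℝ}
  {φ : ℝ → ℝ} {δ : ℝ}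

theorem isCompact_closure_inter_superlevel (hΩb : IsBounded Ω) (hu : Continuous u) :
    IsCompact (closure Ω ∩ {x | δ ≤ |u x|}) :=
  hΩb.isCompact_closure.inter_right (isClosed_le continuous_const hu.abs)

theorem indicator_comp_eq_zero (hφ0 : ∀ t, |t| ≤ δ → φ t = 0) {x : EuclideanSpace ℝ (Fin n)}
    (hx : x ∉ closure Ω ∩ {x | δ ≤ |u x|}) : Ω.indicator (fun y => φ (u y)) x = 0 := by
  by_cases hxΩ : x ∈ Ω
  · rw [Set.indicator_of_mem hxΩ]
    exact hφ0 _ (not_le.1 fun h => hx ⟨subset_closure hxΩ, h⟩).le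
  · exact Set.indicator_of_notMem hxΩ _

theorem hasCompactSupport_indicator_comp (hΩb : IsBounded Ω) (hu : Continuous u)
    (hφ0 : ∀ t, |t| ≤ δ → φ t = 0) :
    HasCompactSupport (Ω.indicator fun y => φ (u y)) :=
  HasCompactSupport.intro (isCompact_closure_inter_superlevel hΩb hu)
    fun _ hx => indicator_comp_eq_zero hφ0 hx

theorem indicator_comp_eventuallyEq (hΩo : IsOpen Ω) {x : EuclideanSpace ℝ (Fin n)} (hx : x ∈ Ω) :
    Ω.indicator (fun y => φ (u y)) =ᶠ[𝓝 x] fun y => φ (u y) := by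
  filter_upwards [hΩo.mem_nhds hx] with y hy
  exact Set.indicator_of_mem hy _

theorem contDiff_indicator_comp (hΩo : IsOpen Ω) (hΩb : IsBounded Ω) (hu : ContDiff ℝ 1 u)
    (hbc : ∀ x ∈ frontier Ω, u x = 0) (hδ : 0 < δ) (hφ : ContDiff ℝ 1 φ)
    (hφ0 : ∀ t, |t| ≤ δ → φ t = 0) :
    ContDiff ℝ 1 (Ω.indicator fun y => φ (u y)) := by
  refine contDiff_iff_contDiffAt.2 fun x => ?_
  by_cases hx : x ∈ Ω
  · exact (hφ.comp hu).contDiffAt.congr_of_eventuallyEq (indicator_comp_eventuallyEq hΩo hx)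
  · have hxK : x ∉ closure Ω ∩ {x | δ ≤ |u x|} := by
      rintro ⟨hxc, hxδ⟩
      have := hbc x (by rw [hΩo.frontier_eq]; exact ⟨hxc, hx⟩)
      simp only [Set.mem_ofPred_eq, this, abs_zero] at hxδ
      linarith
    refine (contDiffAt_const (c := (0 : ℝ))).congr_of_eventuallyEq ?_
    have hKc := (isCompact_closure_inter_superlevel (δ := δ) hΩb hu.continuous).isClosed
    filter_upwards [hKc.isOpen_compl.mem_nhds hxK] with y hy
    exact indicator_comp_eq_zero hφ0 hy

theorem integrableOn_of_isBounded {F : EuclideanSpace ℝ (Fin n) → ℝ} (hΩb : IsBounded Ω)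
    (hF : Continuous F) : IntegrableOn F Ω :=
  (hF.continuousOn.integrableOn_compact hΩb.isCompact_closure).mono_set subset_closure

/-- A compactly supported divergence has zero integral. -/
theorem integral_mul_partialDeriv_add_eq_zero {b η : EuclideanSpace ℝ (Fin n) → ℝ}
    (hb : ContDiff ℝ 1 b) (hη : ContDiff ℝ 1 η) (hηc : HasCompactSupport η) (i : Fin n) :
    ∫ x, (b x * partialDeriv i η x + partialDeriv i b x * η x) = 0 := by
  have hηc' : HasCompactSupport (partialDeriv i η) := hηc.fderiv_apply ℝ _
  have h1 : Integrable (fun x => partialDeriv i b x * η x) :=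
    ((continuous_partialDeriv i hb).mul hη.continuous).integrable_of_hasCompactSupport
      hηc.mul_left
  have h2 : Integrable (fun x => b x * partialDeriv i η x) :=
    (hb.continuous.mul (continuous_partialDeriv i hη)).integrable_of_hasCompactSupport
      hηc'.mul_left
  rw [integral_add h2 h1]
  have := integral_mul_fderiv_eq_neg_fderiv_mul_of_integrable (μ := volume) h1 h2
    ((hb.continuous.mul hη.continuous).integrable_of_hasCompactSupport hηc.mul_left)
    (fun x _ => hb.differentiable (by simp) x) (fun x _ => hη.differentiable (by simp) x)
  unfold partialDeriv
  rw [this, neg_add_cancel]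

end Cutoff

section Energy

variable {n : ℕ} {Ω : Set (EuclideanSpace ℝ (Fin n))} {g : ℝ → ℝ}
  {u : EuclideanSpace ℝ (Fin n) → ℝ}

/-- The squared norm of the Hessian of `u`. -/
noncomputable def hessSq (u : EuclideanSpace ℝ (Fin n) → ℝ) (x : EuclideanSpace ℝ (Fin n)) : ℝ :=
  ∑ i, ∑ j, partialDeriv i (partialDeriv j u) x ^ 2

/-- The `i`-th component of `D²u ∇u`. -/
noncomputable def hessGrad (u : EuclideanSpace ℝ (Fin n) → ℝ) (i : Fin n)
    (x : EuclideanSpace ℝ (Fin n)) : ℝ :=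
  ∑ j, partialDeriv i (partialDeriv j u) x * partialDeriv j u x

theorem contDiff_hessGrad (hu : ContDiff ℝ (⊤ : ℕ∞) u) (i : Fin n) :
    ContDiff ℝ (⊤ : ℕ∞) (hessGrad u i) :=
  ContDiff.sum fun j _ => (contDiff_partialDeriv i (contDiff_partialDeriv j hu)).mul
    (contDiff_partialDeriv j hu)

theorem continuous_hessSq (hu : ContDiff ℝ (⊤ : ℕ∞) u) : Continuous (hessSq u) :=
  continuous_finsetSum _ fun i _ => continuous_finsetSum _ fun j _ =>
    (contDiff_partialDeriv i (contDiff_partialDeriv j hu)).continuous.pow 2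

theorem contDiff_norm_gradient_sq (hu : ContDiff ℝ (⊤ : ℕ∞) u) :
    ContDiff ℝ (⊤ : ℕ∞) fun x => ‖gradient u x‖ ^ 2 := by
  simp_rw [norm_gradient_sq]
  exact ContDiff.sum fun j _ => (contDiff_partialDeriv j hu).pow 2

theorem sum_hessGrad_sq_le (u : EuclideanSpace ℝ (Fin n) → ℝ) (x : EuclideanSpace ℝ (Fin n)) :
    ∑ i, hessGrad u i x ^ 2 ≤ hessSq u x * ‖gradient u x‖ ^ 2 := by
  rw [hessSq, Finset.sum_mul, norm_gradient_sq]
  exact Finset.sum_le_sum fun i _ => Finset.sum_mul_sq_le_sq_mul_sq _ _ _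

/-- The Bochner identity `div (D²u ∇u) = |D²u|² + ∇u · ∇Δu` for solutions of `-Δu = g(u)`. -/
theorem sum_partialDeriv_hessGrad (hΩo : IsOpen Ω) (hg : ContDiff ℝ (⊤ : ℕ∞) g)
    (hu : ContDiff ℝ (⊤ : ℕ∞) u) (heq : ∀ x ∈ Ω, -lap u x = g (u x))
    {x : EuclideanSpace ℝ (Fin n)} (hx : x ∈ Ω) :
    ∑ i, partialDeriv i (hessGrad u i) x =
      hessSq u x - deriv g (u x) * ‖gradient u x‖ ^ 2 := by
  have hd1 (j : Fin n) : DifferentiableAt ℝ (partialDeriv j u) x :=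
    (contDiff_partialDeriv j hu).differentiable (by simp) x
  have hd2 (i j : Fin n) : DifferentiableAt ℝ (partialDeriv i (partialDeriv j u)) x :=
    (contDiff_partialDeriv i (contDiff_partialDeriv j hu)).differentiable (by simp) x
  have hlap (j : Fin n) : ∑ i, partialDeriv i (partialDeriv i (partialDeriv j u)) x =
      -(deriv g (u x) * partialDeriv j u x) := by
    have e1 : (fun y => ∑ i, partialDeriv i (partialDeriv i u) y) =ᶠ[𝓝 x]
        fun y => (fun t => -g t) (u y) := by
      filter_upwards [hΩo.mem_nhds hx] with y hy
      rw [← lap_eq_sum hu, ← heq y hy, neg_neg]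
    have e2 := partialDeriv_congr j e1
    rw [partialDeriv_comp j ((hg.differentiable (by simp) _).fun_neg)
      (hu.differentiable (by simp) x), deriv.fun_neg, partialDeriv_sum _ _ fun i _ => hd2 i i] at e2
    rw [← neg_mul, ← e2]
    refine Finset.sum_congr rfl fun i _ => ?_
    rw [partialDeriv_comm hu i j, partialDeriv_comm (contDiff_partialDeriv i hu) i j]
  have e (i : Fin n) : partialDeriv i (hessGrad u i) x =
      ∑ j, (partialDeriv i (partialDeriv j u) x ^ 2 +
        partialDeriv j u x * partialDeriv i (partialDeriv i (partialDeriv j u)) x) := by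
    unfold hessGrad
    rw [partialDeriv_sum _ _ fun j _ => (hd2 i j).fun_mul (hd1 j)]
    refine Finset.sum_congr rfl fun j _ => ?_
    rw [partialDeriv_mul i (hd2 i j) (hd1 j)]
    ring
  simp_rw [e, Finset.sum_add_distrib]
  rw [hessSq, norm_gradient_sq, sub_eq_add_neg, Finset.mul_sum, ← Finset.sum_neg_distrib,
    Finset.sum_comm (f := fun i j =>
      partialDeriv j u x * partialDeriv i (partialDeriv i (partialDeriv j u)) x)]
  congr 1
  refine Finset.sum_congr rfl fun j _ => ?_
  rw [← Finset.mul_sum, hlap]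
  ring

/-- The stability inequality with the test function `√(|∇u|² + ε) φ(u)`. -/
theorem SemiStable.integral_nonneg (hΩo : IsOpen Ω) (hΩb : IsBounded Ω)
    (hg : ContDiff ℝ (⊤ : ℕ∞) g) (hu : ContDiff ℝ (⊤ : ℕ∞) u)
    (heq : ∀ x ∈ Ω, -lap u x = g (u x)) (hbc : ∀ x ∈ frontier Ω, u x = 0)
    (hstab : SemiStable Ω g u) {φ : ℝ → ℝ} {δ ε : ℝ} (hδ : 0 < δ) (hε : 0 < ε)
    (hφ : ContDiff ℝ 1 φ) (hφ0 : ∀ t, |t| ≤ δ → φ t = 0) :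
    0 ≤ ∫ x in Ω, (deriv φ (u x) ^ 2 * (‖gradient u x‖ ^ 2 * (‖gradient u x‖ ^ 2 + ε))
      - ε * (deriv g (u x) * φ (u x) ^ 2)
      - φ (u x) ^ 2 *
        (hessSq u x - (∑ i, hessGrad u i x ^ 2) / (‖gradient u x‖ ^ 2 + ε))) := by
  have hu1 : ContDiff ℝ 1 u := hu.of_le (by exact WithTop.coe_le_coe.2 le_top)
  set η : EuclideanSpace ℝ (Fin n) → ℝ := Ω.indicator fun y => φ (u y) with hη
  have hη1 : ContDiff ℝ 1 η := contDiff_indicator_comp hΩo hΩb hu1 hbc hδ hφ hφ0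
  have hηc : HasCompactSupport η := hasCompactSupport_indicator_comp hΩb hu.continuous hφ0
  set w : EuclideanSpace ℝ (Fin n) → ℝ := fun x => ‖gradient u x‖ ^ 2 + ε with hw
  have hwpos (x : EuclideanSpace ℝ (Fin n)) : 0 < w x := by positivity
  have hw1 : ContDiff ℝ 1 w :=
    ((contDiff_norm_gradient_sq hu).add contDiff_const).of_le
      (by exact WithTop.coe_le_coe.2 le_top)
  have hc1 : ContDiff ℝ 1 fun x => √(w x) := hw1.sqrt fun x => (hwpos x).ne'
  have hηd (x : EuclideanSpace ℝ (Fin n)) : DifferentiableAt ℝ η x :=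
    hη1.differentiable (by simp) x
  have hb1 (i : Fin n) : ContDiff ℝ 1 (hessGrad u i) :=
    (contDiff_hessGrad hu i).of_le (by exact WithTop.coe_le_coe.2 le_top)
  have hη2 : ContDiff ℝ 1 fun x => η x * η x := hη1.mul hη1
  have hη2c : HasCompactSupport fun x => η x * η x := hηc.mul_left
  have hpw (i : Fin n) (x : EuclideanSpace ℝ (Fin n)) :
      partialDeriv i w x = 2 * hessGrad u i x := by
    have : w = fun y => ∑ j, partialDeriv j u y ^ 2 + ε := by
      ext y
      simp only [hw, norm_gradient_sq]
    rw [hessGrad, ← partialDeriv_sum_sq hu, this]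
    unfold partialDeriv
    rw [fderiv_add_const]
  set R : EuclideanSpace ℝ (Fin n) → ℝ := fun x => ∑ i, (hessGrad u i x *
    partialDeriv i (fun y => η y * η y) x + partialDeriv i (hessGrad u i) x * (η x * η x)) with hR
  have hRcont : Continuous R := continuous_finsetSum _ fun i _ =>
    ((hb1 i).continuous.mul (continuous_partialDeriv i hη2)).add
      ((continuous_partialDeriv i (hb1 i)).mul hη2.continuous)
  have hRint : ∫ x in Ω, R x = 0 := by
    rw [setIntegral_eq_integral_of_forall_compl_eq_zero]
    · rw [integral_finsetSum]
      · exact Finset.sum_eq_zero fun i _ =>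
          integral_mul_partialDeriv_add_eq_zero (hb1 i) hη2 hη2c i
      · intro i _
        refine Continuous.integrable_of_hasCompactSupport ?_ ?_
        · exact ((hb1 i).continuous.mul (continuous_partialDeriv i hη2)).add
            ((continuous_partialDeriv i (hb1 i)).mul hη2.continuous)
        · exact HasCompactSupport.add (hη2c.fderiv_apply ℝ _).mul_left hη2c.mul_left
    · intro x hx
      have h0 : η x = 0 := Set.indicator_of_notMem hx _
      refine Finset.sum_eq_zero fun i _ => ?_
      rw [partialDeriv_mul i (hηd x) (hηd x), h0]
      ring
  have hgu : Continuous fun x => deriv g (u x) :=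
    (hg.continuous_deriv (by simp)).comp hu.continuous
  have hG : Continuous fun x => ‖gradient u x‖ ^ 2 := (contDiff_norm_gradient_sq hu).continuous
  have hφu : Continuous fun x => φ (u x) := hφ.continuous.comp hu.continuous
  have hφ'u : Continuous fun x => deriv φ (u x) :=
    (hφ.continuous_deriv (by simp)).comp hu.continuous
  set F : EuclideanSpace ℝ (Fin n) → ℝ := fun x =>
    deriv φ (u x) ^ 2 * (‖gradient u x‖ ^ 2 * (‖gradient u x‖ ^ 2 + ε))
      - ε * (deriv g (u x) * φ (u x) ^ 2)
      - φ (u x) ^ 2 *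
        (hessSq u x - (∑ i, hessGrad u i x ^ 2) / (‖gradient u x‖ ^ 2 + ε)) with hF
  have hFcont : Continuous F := by
    refine (((hφ'u.pow 2).mul (hG.mul (hG.add continuous_const))).sub
      (continuous_const.mul (hgu.mul (hφu.pow 2)))).sub ((hφu.pow 2).mul
      ((continuous_hessSq hu).sub (Continuous.div ?_ (hG.add continuous_const) ?_)))
    · exact continuous_finsetSum _ fun i _ => (hb1 i).continuous.pow 2
    · exact fun x => (hwpos x).ne'
  have hkey := hstab (fun x => √(w x) * η x) (hc1.mul hη1) fun x hx => by
    have : x ∉ Ω := fun h => by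
      rw [hΩo.frontier_eq] at hx
      exact hx.2 h
    simp [hη, Set.indicator_of_notMem this]
  have hcongr : ∀ x ∈ Ω, ‖gradient (fun x => √(w x) * η x) x‖ ^ 2 -
      deriv g (u x) * (√(w x) * η x) ^ 2 = F x + R x := by
    intro x hx
    have hηx : η x = φ (u x) := Set.indicator_of_mem hx _
    have hηp (i : Fin n) : partialDeriv i η x = deriv φ (u x) * partialDeriv i u x := by
      rw [partialDeriv_congr i (indicator_comp_eventuallyEq hΩo hx),
        partialDeriv_comp i (hφ.differentiable (by simp) _) (hu.differentiable (by simp) x)]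
    have hsq : √(w x) ^ 2 = w x := Real.sq_sqrt (hwpos x).le
    have hs0 : √(w x) ≠ 0 := (Real.sqrt_pos.2 (hwpos x)).ne'
    have hterm (i : Fin n) : partialDeriv i (fun x => √(w x) * η x) x ^ 2 =
        w x * deriv φ (u x) ^ 2 * partialDeriv i u x ^ 2 +
        hessGrad u i x * partialDeriv i (fun y => η y * η y) x +
        φ (u x) ^ 2 / w x * hessGrad u i x ^ 2 := by
      rw [partialDeriv_mul i (hc1.differentiable (by simp) x) (hηd x),
        partialDeriv_mul i (hηd x) (hηd x),
        partialDeriv_sqrt i (hw1.differentiable (by simp) x) (hwpos x).ne', hpw, hηp, hηx]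
      generalize √(w x) = r at hsq hs0 ⊢
      rw [← hsq]
      field_simp
      ring
    rw [norm_gradient_sq]
    simp_rw [hterm]
    simp only [hR, Finset.sum_add_distrib, ← Finset.mul_sum, ← Finset.sum_mul]
    rw [sum_partialDeriv_hessGrad hΩo hg hu heq hx, ← norm_gradient_sq, mul_pow, hsq, hηx]
    simp only [hF, hw]
    ring
  rwa [setIntegral_congr_fun hΩo.measurableSet hcongr,
    integral_add (integrableOn_of_isBounded hΩb hFcont) (integrableOn_of_isBounded hΩb hRcont),
    hRint, add_zero] at hkey

theorem sq_meanCurv_mul_le (hn : 2 ≤ n) (hu : ContDiff ℝ (⊤ : ℕ∞) u)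
    {x : EuclideanSpace ℝ (Fin n)} (hx : gradient u x ≠ 0) :
    ((n : ℝ) - 1) * (meanCurv u x ^ 2 * ‖gradient u x‖ ^ 2) ≤
      hessSq u x - (∑ i, hessGrad u i x ^ 2) / ‖gradient u x‖ ^ 2 := by
  have hn' : (0 : ℝ) < (n : ℝ) - 1 := by
    have : (2 : ℝ) ≤ n := by exact_mod_cast hn
    linarith
  have hG : ∑ i, partialDeriv i u x ^ 2 ≠ 0 := by
    rw [← norm_gradient_sq]
    exact pow_ne_zero 2 (norm_ne_zero_iff.2 hx)
  have h := sq_trace_sub_le (fun i j => partialDeriv i (partialDeriv j u) x)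
    (fun i => partialDeriv i u x) hG
  rw [← divg_normalized_gradient hu hx, ← norm_gradient_sq] at h
  have e : ((n : ℝ) - 1) * (meanCurv u x ^ 2 * ‖gradient u x‖ ^ 2) =
      (divg (fun y => ‖gradient u y‖⁻¹ • gradient u y) x * ‖gradient u x‖) ^ 2 /
        ((n : ℝ) - 1) := by
    rw [meanCurv]
    field_simp
  rw [e, div_le_iff₀ hn', mul_comm _ ((n : ℝ) - 1)]
  exact h

end Energy

theorem le_of_forall_add_mul {A J C : ℝ} (h : ∀ ε, 0 < ε → A ≤ J + ε * C) : A ≤ J := by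
  have ht : Tendsto (fun ε : ℝ => J + ε * C) (𝓝[>] 0) (𝓝 (J + 0 * C)) :=
    (Continuous.tendsto (by fun_prop) 0).mono_left nhdsWithin_le_nhds
  rw [zero_mul, add_zero] at ht
  exact ge_of_tendsto ht (eventually_nhdsWithin_of_forall h)

/-- Inequality (1.5)/(3.4), obtained by taking the truncation of `|u|` at level `s` as test
function: `(n-1) s² ∫_{{|u|>s}∩{|∇u|>0}} H_u² |∇u|² dx ≤ ∫_{{|u|≤s}} |∇u|⁴ dx`. -/
theorem stmt_9 (n : ℕ) (hn : 2 ≤ n)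
    (Ω : Set (EuclideanSpace ℝ (Fin n))) (hΩo : IsOpen Ω) (hΩb : IsBounded Ω)
    (g : ℝ → ℝ) (hg : ContDiff ℝ (⊤ : ℕ∞) g)
    (u : EuclideanSpace ℝ (Fin n) → ℝ) (hu : ContDiff ℝ (⊤ : ℕ∞) u)
    (heq : ∀ x ∈ Ω, -lap u x = g (u x))
    (hbc : ∀ x ∈ frontier Ω, u x = 0)
    (hstab : SemiStable Ω g u) :
    ∀ s : ℝ, 0 < s →
      ((n : ℝ) - 1) * s ^ 2 *
          ∫ x in Ω ∩ {x | s < |u x|} ∩ {x | gradient u x ≠ 0},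
            meanCurv u x ^ 2 * ‖gradient u x‖ ^ 2 ≤
        ∫ x in Ω ∩ {x | |u x| ≤ s}, ‖gradient u x‖ ^ 4 := by

  intro s hs
  set I := ∫ x in Ω ∩ {x | s < |u x|} ∩ {x | gradient u x ≠ 0},
    meanCurv u x ^ 2 * ‖gradient u x‖ ^ 2 with hI
  set J := ∫ x in Ω ∩ {x | |u x| ≤ s}, ‖gradient u x‖ ^ 4 with hJ
  have hn' : (0 : ℝ) < (n : ℝ) - 1 := by
    have : (2 : ℝ) ≤ n := by exact_mod_cast hn
    linarith
  have hGc : Continuous fun x => ‖gradient u x‖ ^ 2 := (contDiff_norm_gradient_sq hu).continuous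
  have hgu : Continuous fun x => deriv g (u x) :=
    (hg.continuous_deriv (by simp)).comp hu.continuous
  have htrunc : ∀ δ, 0 < δ → 3 * δ < s → ((n : ℝ) - 1) * (s - 3 * δ) ^ 2 * I ≤ J := by
    intro δ hδ hδs
    obtain ⟨φ, hφ, hφ0, hφ1, hφ', hφs⟩ := exists_truncation hδ hδs
    have hφu : Continuous fun x => φ (u x) := hφ.continuous.comp hu.continuous
    have hφ'u : Continuous fun x => deriv φ (u x) :=
      (hφ.continuous_deriv (by simp)).comp hu.continuous
    set P : EuclideanSpace ℝ (Fin n) → ℝ := fun x => deriv φ (u x) ^ 2 * ‖gradient u x‖ ^ 4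
    set Q : EuclideanSpace ℝ (Fin n) → ℝ := fun x =>
      deriv φ (u x) ^ 2 * ‖gradient u x‖ ^ 2 - deriv g (u x) * φ (u x) ^ 2
    have hG4 : Continuous fun x => ‖gradient u x‖ ^ 4 := by
      convert! hGc.pow 2 using 2 with x
      rw [Pi.pow_apply]
      ring
    have hPc : Continuous P := (hφ'u.pow 2).mul hG4
    have hQc : Continuous Q := ((hφ'u.pow 2).mul hGc).sub (hgu.mul (hφu.pow 2))
    have hPJ : ∫ x in Ω, P x ≤ J := by
      have hS : MeasurableSet {x | |u x| ≤ s} :=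
        (isClosed_le hu.continuous.abs continuous_const).measurableSet
      rw [hJ, ← setIntegral_indicator hS]
      refine integral_mono (integrableOn_of_isBounded hΩb hPc)
        ((integrableOn_of_isBounded hΩb hG4).indicator hS) fun x => ?_
      by_cases hx : |u x| ≤ s
      · rw [Set.indicator_of_mem (show x ∈ {x | |u x| ≤ s} from hx)]
        exact mul_le_of_le_one_left (by positivity) (hφ1 _)
      · rw [Set.indicator_of_notMem (show x ∉ {x | |u x| ≤ s} from hx)]
        simp [P, hφ' (u x) (not_le.1 hx).le]
    refine le_of_forall_add_mul (C := ∫ x in Ω, Q x) fun ε hε => ?_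
    set D : EuclideanSpace ℝ (Fin n) → ℝ := fun x => φ (u x) ^ 2 *
      (hessSq u x - (∑ i, hessGrad u i x ^ 2) / (‖gradient u x‖ ^ 2 + ε))
    have hDc : Continuous D := by
      refine (hφu.pow 2).mul ((continuous_hessSq hu).sub
        (Continuous.div ?_ (hGc.add continuous_const) fun x => by positivity))
      exact continuous_finsetSum _ fun i _ => (contDiff_hessGrad hu i).continuous.pow 2
    have hD0 (x : EuclideanSpace ℝ (Fin n)) : 0 ≤ D x := by
      refine mul_nonneg (sq_nonneg _) (sub_nonneg.2 ((div_le_iff₀ (by positivity)).2 ?_))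
      refine (sum_hessGrad_sq_le u x).trans (mul_le_mul_of_nonneg_left (by linarith) ?_)
      exact Finset.sum_nonneg fun i _ => Finset.sum_nonneg fun j _ => sq_nonneg _
    have hDi := integrableOn_of_isBounded hΩb hDc
    have hID : ((n : ℝ) - 1) * (s - 3 * δ) ^ 2 * I ≤ ∫ x in Ω, D x := by
      have hsub : Ω ∩ {x | s < |u x|} ∩ {x | gradient u x ≠ 0} ⊆ Ω := fun x hx => hx.1.1
      have hmeas : MeasurableSet (Ω ∩ {x | s < |u x|} ∩ {x | gradient u x ≠ 0}) := by
        refine (hΩo.inter (isOpen_lt continuous_const hu.continuous.abs)).measurableSet.inter ?_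
        have : {x | gradient u x ≠ 0} = {x | ‖gradient u x‖ ^ 2 ≠ 0} := by
          ext x
          simp
        rw [this]
        exact (isOpen_ne_fun hGc continuous_const).measurableSet
      refine le_trans ?_ (setIntegral_mono_set hDi (Eventually.of_forall hD0)
        (Eventually.of_forall hsub))
      rw [hI, ← integral_const_mul]
      refine integral_mono_of_nonneg (Eventually.of_forall fun x => by positivity)
        (hDi.mono_set hsub) ((ae_restrict_iff' hmeas).2 (Eventually.of_forall fun x hx => ?_))
      have hx0 : 0 < ‖gradient u x‖ := norm_pos_iff.2 hx.2
      have h1 : ((n : ℝ) - 1) * (meanCurv u x ^ 2 * ‖gradient u x‖ ^ 2) ≤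
          hessSq u x - (∑ i, hessGrad u i x ^ 2) / (‖gradient u x‖ ^ 2 + ε) :=
        (sq_meanCurv_mul_le hn hu hx.2).trans (sub_le_sub_left
          (div_le_div_of_nonneg_left (Finset.sum_nonneg fun i _ => sq_nonneg _)
            (by positivity) (by linarith)) _)
      have h2 := mul_le_mul (hφs (u x) (le_of_lt hx.1.2)) h1 (by positivity) (sq_nonneg _)
      calc _ = (s - 3 * δ) ^ 2 *
            (((n : ℝ) - 1) * (meanCurv u x ^ 2 * ‖gradient u x‖ ^ 2)) := by ring
        _ ≤ D x := h2
    have hstab' := hstab.integral_nonneg hΩo hΩb hg hu heq hbc hδ hε hφ hφ0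
    have hPi := integrableOn_of_isBounded hΩb hPc
    have hQi := (integrableOn_of_isBounded hΩb hQc).const_mul ε
    have hPQ : IntegrableOn (fun x => P x + ε * Q x) Ω := hPi.add hQi
    have hsplit : (fun x => deriv φ (u x) ^ 2 *
          (‖gradient u x‖ ^ 2 * (‖gradient u x‖ ^ 2 + ε)) - ε * (deriv g (u x) * φ (u x) ^ 2)
        - φ (u x) ^ 2 * (hessSq u x - (∑ i, hessGrad u i x ^ 2) / (‖gradient u x‖ ^ 2 + ε))) =
        fun x => P x + ε * Q x - D x := by
      ext x
      simp only [P, Q, D]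
      ring
    rw [hsplit, integral_sub hPQ hDi, integral_add hPi hQi, integral_const_mul] at hstab'
    linarith
  have hlim : Tendsto (fun δ : ℝ => ((n : ℝ) - 1) * (s - 3 * δ) ^ 2 * I) (𝓝[>] 0)
      (𝓝 (((n : ℝ) - 1) * (s - 3 * 0) ^ 2 * I)) :=
    (Continuous.tendsto (by fun_prop) 0).mono_left nhdsWithin_le_nhds
  rw [mul_zero, sub_zero] at hlim
  refine le_of_tendsto hlim ?_
  filter_upwards [Ioo_mem_nhdsGT (show (0 : ℝ) < s / 3 by positivity)] with δ hδ
  exact htrunc δ hδ.1 (by linarith [hδ.2])
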